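/- min_{ξ∈K₀} Ψ(ξ) = min{ Ψ(ξ) : ξ ∈ K, min_{j≠k}|ξ_j − ξ_k| = M^{−1} } tends to +∞ as M → +∞; that is, for every R ∈ ℝ there exists M₁ > 0 such that Ψ(ξ) ≥ R for every M ≥ M₁ and every ξ ∈ K₀. -/

import Mathlib

open Real Set Metric Filter MeasureTheory

/-- The Laplacian of a real-valued function on the plane ℝ² ≅ ℂ. -/
noncomputable def planeLap (f : ℂ → ℝ) (x : ℂ) : ℝ :=
  fderiv ℝ (fun y => fderiv ℝ f y 1) x 1 +
  fderiv ℝ (fun y => fderiv ℝ f y Complex.I) x Complex.I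

/-- A function is harmonic on a set if it is C² there with vanishing Laplacian. -/
def HarmonicOnSet (f : ℂ → ℝ) (s : Set ℂ) : Prop :=
  ContDiffOn ℝ 2 f s ∧ ∀ x ∈ s, planeLap f x = 0

/-- `RegPart Ω H`: H is the regular part of the Dirichlet Green's function of −Δ on Ω:
for each x ∈ Ω, y ↦ H(x,y) is harmonic on Ω, extends continuously to the closure of Ω,
with boundary values (1/(2π))·log|x−y| on ∂Ω; moreover H is symmetric on Ω × Ω. -/
def RegPart (Ω : Set ℂ) (H : ℂ → ℂ → ℝ) : Prop :=
  (∀ x ∈ Ω, HarmonicOnSet (fun y => H x y) Ω ∧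
      ContinuousOn (fun y => H x y) (closure Ω) ∧
      ∀ y ∈ frontier Ω, H x y = (1 / (2 * π)) * Real.log ‖x - y‖) ∧
  (∀ x ∈ Ω, ∀ y ∈ Ω, H x y = H y x)

/-- The Green's function G(x,y) = (1/(2π))·log(1/|x−y|) + H(x,y). -/
noncomputable def green (H : ℂ → ℂ → ℝ) (x y : ℂ) : ℝ :=
  (1 / (2 * π)) * Real.log (1 / ‖x - y‖) + H x y

/-- The function Ψ(ξ) = (1/2)ΣH(ξ_j,ξ_j) − Σ_p (α_p/2)Σ_j G(ξ_j,p) + (1/2)Σ_{j≠k}G(ξ_j,ξ_k). -/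
noncomputable def PsiFun (H : ℂ → ℂ → ℝ) (Z : Finset ℂ) (α : ℂ → ℝ) {N : ℕ}
    (ξ : Fin N → ℂ) : ℝ :=
  (1 / 2) * ∑ j, H (ξ j) (ξ j) - ∑ p ∈ Z, (α p / 2) * ∑ j, green H (ξ j) p +
    (1 / 2) * ∑ j, ∑ k, if j ≠ k then green H (ξ j) (ξ k) else 0

/-- The function Φ(ξ) = (1/2)ΣH(ξ_j,ξ_j) − Σ_p (α_p/2)Σ_j G(ξ_j,p) − (1/2)Σ_{j≠k}G(ξ_j,ξ_k). -/
noncomputable def PhiFun (H : ℂ → ℂ → ℝ) (Z : Finset ℂ) (α : ℂ → ℝ) {N : ℕ}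
    (ξ : Fin N → ℂ) : ℝ :=
  (1 / 2) * ∑ j, H (ξ j) (ξ j) - ∑ p ∈ Z, (α p / 2) * ∑ j, green H (ξ j) p -
    (1 / 2) * ∑ j, ∑ k, if j ≠ k then green H (ξ j) (ξ k) else 0

/-- Membership in the configuration space ℳ = {ξ ∈ (Ω∖Z)^N : ξ_j ≠ ξ_k for j ≠ k}. -/
def memM (Ω : Set ℂ) (Z : Finset ℂ) {N : ℕ} (ξ : Fin N → ℂ) : Prop :=
  (∀ j, ξ j ∈ Ω ∧ ξ j ∉ Z) ∧ Function.Injective ξ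

/-- The cone {p + ρe^{i(θ_p+t)} : ρ ≥ 0, |t| ≤ δ} with vertex p. -/
def coneAt (θ : ℂ → ℝ) (δ : ℝ) (p : ℂ) : Set ℂ :=
  {z | ∃ ρ : ℝ, 0 ≤ ρ ∧ ∃ t : ℝ, |t| ≤ δ ∧
    z = p + (ρ : ℂ) * Complex.exp (((θ p + t : ℝ) : ℂ) * Complex.I)}

/-- Start index of the r-th consecutive block I_r of {0,…,N−1}. -/
def blkLo {m : ℕ} (Nr : Fin m → ℕ) (r : Fin m) : ℕ :=
  ∑ s ∈ Finset.univ.filter (fun s => s < r), Nr s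

/-- `inBlk Nr r j`: the index j belongs to the r-th consecutive block I_r. -/
def inBlk {m : ℕ} (Nr : Fin m → ℕ) (r : Fin m) {N : ℕ} (j : Fin N) : Prop :=
  blkLo Nr r ≤ (j : ℕ) ∧ (j : ℕ) < blkLo Nr r + Nr r

/-- `onRays θ δ P Nr ξ`: for every r and every j ∈ I_r the point ξ_j lies on the ray
emanating from p_r with angle θ_{p_r} + jδ/N, i.e. (ξ_j − p_r)/|ξ_j − p_r| = e^{i(θ_{p_r}+jδ/N)}. -/
def onRays (θ : ℂ → ℝ) (δ : ℝ) {m : ℕ} (P : Fin m → ℂ) (Nr : Fin m → ℕ) {N : ℕ}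
    (ξ : Fin N → ℂ) : Prop :=
  ∀ r : Fin m, ∀ j : Fin N, inBlk Nr r j →
    ξ j - P r = (‖ξ j - P r‖ : ℂ) *
      Complex.exp (((θ (P r) + ((j : ℕ) + 1) * δ / (N : ℝ) : ℝ) : ℂ) * Complex.I)

/-- The annulus U_r = {ξ : δ < |ξ − p| < 2δ}. -/
def annU (δ : ℝ) (p : ℂ) : Set ℂ := {z | δ < ‖z - p‖ ∧ ‖z - p‖ < 2 * δ}

/-- The open set {ξ ∈ U₁^{N₁} × … × U_m^{N_m} : |ξ_j − ξ_k| > M⁻¹ for j ≠ k}. -/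
def cfgOpen (δ : ℝ) {m : ℕ} (P : Fin m → ℂ) (Nr : Fin m → ℕ) (N : ℕ) (M : ℝ) :
    Set (Fin N → ℂ) :=
  {ξ | (∀ r : Fin m, ∀ j : Fin N, inBlk Nr r j → ξ j ∈ annU δ (P r)) ∧
    ∀ j k : Fin N, j ≠ k → M⁻¹ < ‖ξ j - ξ k‖}

/-- W = the connected component of the above open set containing ξ⁰. -/
def Wset (δ : ℝ) {m : ℕ} (P : Fin m → ℂ) (Nr : Fin m → ℕ) {N : ℕ} (ξ0 : Fin N → ℂ)
    (M : ℝ) : Set (Fin N → ℂ) :=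
  connectedComponentIn (cfgOpen δ P Nr N M) ξ0

/-- K = the closure of W. -/
def Kset (δ : ℝ) {m : ℕ} (P : Fin m → ℂ) (Nr : Fin m → ℕ) {N : ℕ} (ξ0 : Fin N → ℂ)
    (M : ℝ) : Set (Fin N → ℂ) :=
  closure (Wset δ P Nr ξ0 M)

/-- K₀ = {ξ ∈ K : min_{j≠k}|ξ_j − ξ_k| = M⁻¹}. -/
def K0set (δ : ℝ) {m : ℕ} (P : Fin m → ℂ) (Nr : Fin m → ℕ) {N : ℕ} (ξ0 : Fin N → ℂ)
    (M : ℝ) : Set (Fin N → ℂ) :=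
  {ξ | ξ ∈ Kset δ P Nr ξ0 M ∧ (∀ j k : Fin N, j ≠ k → M⁻¹ ≤ ‖ξ j - ξ k‖) ∧
    ∃ j k : Fin N, j ≠ k ∧ ‖ξ j - ξ k‖ = M⁻¹}

/-- 𝒟 = {ξ ∈ ℳ : Φ(ξ) > −M}. -/
def Dset (Ω : Set ℂ) (H : ℂ → ℂ → ℝ) (Z : Finset ℂ) (α : ℂ → ℝ) {N : ℕ} (M : ℝ) :
    Set (Fin N → ℂ) :=
  {ξ | memM Ω Z ξ ∧ -M < PhiFun H Z α ξ}

/-- ℱ: continuous maps γ : K → 𝒟 homotopic to the identity within 𝒟, the homotopy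
fixing K₀ pointwise. -/
def inF (Ω : Set ℂ) (H : ℂ → ℂ → ℝ) (Z : Finset ℂ) (α : ℂ → ℝ) (δ : ℝ) {m : ℕ}
    (P : Fin m → ℂ) (Nr : Fin m → ℕ) {N : ℕ} (ξ0 : Fin N → ℂ) (M : ℝ)
    (γ : (Fin N → ℂ) → (Fin N → ℂ)) : Prop :=
  ContinuousOn γ (Kset δ P Nr ξ0 M) ∧
  Set.MapsTo γ (Kset δ P Nr ξ0 M) (Dset Ω H Z α M) ∧
  ∃ Γ : ℝ × (Fin N → ℂ) → (Fin N → ℂ),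
    ContinuousOn Γ (Set.Icc (0 : ℝ) 1 ×ˢ Kset δ P Nr ξ0 M) ∧
    Set.MapsTo Γ (Set.Icc (0 : ℝ) 1 ×ˢ Kset δ P Nr ξ0 M) (Dset Ω H Z α M) ∧
    (∀ ξ ∈ Kset δ P Nr ξ0 M, Γ (0, ξ) = ξ) ∧
    (∀ ξ ∈ Kset δ P Nr ξ0 M, Γ (1, ξ) = γ ξ) ∧
    ∀ t ∈ Set.Icc (0 : ℝ) 1, ∀ ξ ∈ K0set δ P Nr ξ0 M, Γ (t, ξ) = ξ

/-- The max-min value Ψ*_M = sup_{γ∈ℱ} min_{ξ∈K} Ψ(γ(ξ)). -/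
noncomputable def PsiStar (Ω : Set ℂ) (H : ℂ → ℂ → ℝ) (Z : Finset ℂ) (α : ℂ → ℝ)
    (δ : ℝ) {m : ℕ} (P : Fin m → ℂ) (Nr : Fin m → ℕ) {N : ℕ} (ξ0 : Fin N → ℂ)
    (M : ℝ) : ℝ :=
  sSup {v | ∃ γ : (Fin N → ℂ) → (Fin N → ℂ), inF Ω H Z α δ P Nr ξ0 M γ ∧
    v = sInf ((fun ξ => PsiFun H Z α (γ ξ)) '' Kset δ P Nr ξ0 M)}

theorem IsLocalMin.nonneg_of_hasDerivAt_hasDerivAt {u u' : ℝ → ℝ} {x a : ℝ} (hmin : IsLocalMin u x)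
    (hu : ∀ᶠ t in nhds x, HasDerivAt u (u' t) t) (hu' : HasDerivAt u' a x) : 0 ≤ a := by
  by_contra! ha
  have hderiv : deriv u =ᶠ[nhds x] u' := hu.mono fun t ht => ht.deriv
  have h2 : deriv (deriv u) x = a := hderiv.deriv_eq.trans hu'.deriv
  have hmax : IsLocalMax u x :=
    isLocalMax_of_deriv_deriv_neg (h2 ▸ ha) hmin.deriv_eq_zero hu.self_of_nhds.continuousAt
  have hconst : u =ᶠ[nhds x] fun _ => u x :=
    (hmin.and hmax).mono fun t ht => le_antisymm ht.2 ht.1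
  have h3 : deriv (deriv u) x = 0 := by
    rw [hconst.deriv.deriv_eq]
    simp
  linarith

theorem IsLocalMin.two_mul_le_fderiv_fderiv {f : ℂ → ℝ} {s : Set ℂ} (hs : IsOpen s)
    (hf : ContDiffOn ℝ 2 f s) {y : ℂ} (hy : y ∈ s) {ε : ℝ}
    (hmin : IsLocalMin (fun z => f z - ε * Complex.normSq z) y) {v : ℂ}
    (hv : Complex.normSq v = 1) :
    2 * ε ≤ fderiv ℝ (fun z => fderiv ℝ f z v) y v := by
  have hline : ∀ t : ℝ, HasDerivAt (fun t : ℝ => y + t • v) v t := fun t => by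
    simpa using ((hasDerivAt_id t).smul_const v).const_add y
  have hcont : ContinuousAt (fun t : ℝ => y + t • v) 0 := (hline 0).continuousAt
  have hy0 : y + (0 : ℝ) • v = y := by simp
  have hmem : ∀ᶠ t : ℝ in nhds 0, y + t • v ∈ s :=
    hcont.eventually_mem (by rw [hy0]; exact hs.mem_nhds hy)
  have hdiff : DifferentiableAt ℝ (fun z => fderiv ℝ f z v) y :=
    (((hf.contDiffAt (hs.mem_nhds hy)).fderiv_right (m := 1) (by norm_num)).differentiableAt
      (by norm_num)).clm_apply (differentiableAt_const v)
  have hsq : ∀ t : ℝ, Complex.normSq (y + t • v) =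
      Complex.normSq y + 2 * t * (y.re * v.re + y.im * v.im) + t ^ 2 := fun t => by
    have hv' := hv
    simp only [Complex.normSq_apply] at hv' ⊢
    simp only [Complex.add_re, Complex.add_im, Complex.real_smul, Complex.re_ofReal_mul,
      Complex.im_ofReal_mul]
    linear_combination t ^ 2 * hv'
  have hmin' : IsLocalMin (fun t : ℝ => f (y + t • v) - ε * Complex.normSq (y + t • v)) 0 := by
    have := hcont.eventually (p := fun z => f y - ε * Complex.normSq y ≤
      f z - ε * Complex.normSq z) (by simp only [hy0]; exact hmin)
    filter_upwards [this] with t ht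
    simpa only [hy0] using ht
  have hfirst : ∀ᶠ t : ℝ in nhds 0,
      HasDerivAt (fun t : ℝ => f (y + t • v) - ε * Complex.normSq (y + t • v))
        (fderiv ℝ f (y + t • v) v - ε * (2 * (y.re * v.re + y.im * v.im) + 2 * t)) t := by
    filter_upwards [hmem] with t ht
    have hft : HasFDerivAt f (fderiv ℝ f (y + t • v)) (y + t • v) :=
      ((hf.contDiffAt (hs.mem_nhds ht)).differentiableAt (by norm_num)).hasFDerivAt
    refine (hft.comp_hasDerivAt t (hline t)).sub (HasDerivAt.const_mul ε ?_)
    simp only [hsq]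
    have h1 := (((hasDerivAt_id t).const_mul 2).mul_const
      (y.re * v.re + y.im * v.im)).const_add (Complex.normSq y)
    exact (h1.add (hasDerivAt_pow 2 t)).congr_deriv (by simp)
  have hsecond : HasDerivAt (fun t : ℝ => fderiv ℝ f (y + t • v) v -
      ε * (2 * (y.re * v.re + y.im * v.im) + 2 * t))
      (fderiv ℝ (fun z => fderiv ℝ f z v) y v - ε * 2) 0 := by
    have hd : HasFDerivAt (fun z => fderiv ℝ f z v) (fderiv ℝ (fun z => fderiv ℝ f z v) y)
        (y + (0 : ℝ) • v) := by rw [hy0]; exact hdiff.hasFDerivAt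
    refine (hd.comp_hasDerivAt 0 (hline 0)).sub (HasDerivAt.const_mul ε ?_)
    simpa using ((hasDerivAt_id (0 : ℝ)).const_mul 2).const_add
      (2 * (y.re * v.re + y.im * v.im))
  have := hmin'.nonneg_of_hasDerivAt_hasDerivAt hfirst hsecond
  linarith

/-- The minimum principle for harmonic functions on a bounded open subset of the plane. -/
theorem HarmonicOnSet.le_of_le_on_frontier {Ω : Set ℂ} (hΩo : IsOpen Ω)
    (hΩb : Bornology.IsBounded Ω) {f : ℂ → ℝ} (hf : HarmonicOnSet f Ω)
    (hfc : ContinuousOn f (closure Ω)) {c : ℝ} (hc : ∀ y ∈ frontier Ω, c ≤ f y)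
    {x : ℂ} (hx : x ∈ Ω) : c ≤ f x := by
  by_contra! hlt
  obtain ⟨R, hR⟩ := hΩb.closure.exists_norm_le
  have hcomp : IsCompact (closure Ω) := hΩb.isCompact_closure
  set ε : ℝ := (c - f x) / (2 * (R ^ 2 + 1)) with hε
  have hε0 : 0 < ε := div_pos (by linarith) (by positivity)
  have hεR : ε * (R ^ 2 + 1) = (c - f x) / 2 := by
    rw [hε]; field_simp
  obtain ⟨y, hy, hymin⟩ := hcomp.exists_isMinOn ⟨x, subset_closure hx⟩
    (f := fun z => f z - ε * Complex.normSq z)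
    (hfc.sub (continuousOn_const.mul Complex.continuous_normSq.continuousOn))
  have hyx : f y - ε * Complex.normSq y ≤ f x - ε * Complex.normSq x :=
    hymin (subset_closure hx)
  have hyR : Complex.normSq y ≤ R ^ 2 := by
    rw [Complex.normSq_eq_norm_sq]
    exact pow_le_pow_left₀ (norm_nonneg y) (hR y hy) 2
  have hyΩ : y ∈ Ω := by
    by_contra hyn
    have h1 := hc y ⟨hy, by rwa [hΩo.interior_eq]⟩
    have h2 := mul_le_mul_of_nonneg_left hyR hε0.le
    have h3 := mul_nonneg hε0.le (Complex.normSq_nonneg x)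
    nlinarith
  have hloc : IsLocalMin (fun z => f z - ε * Complex.normSq z) y :=
    hymin.isLocalMin (mem_of_superset (hΩo.mem_nhds hyΩ) subset_closure)
  have h1 := hloc.two_mul_le_fderiv_fderiv hΩo hf.1 hyΩ (v := 1) (by simp)
  have hI := hloc.two_mul_le_fderiv_fderiv hΩo hf.1 hyΩ (v := Complex.I) (by simp)
  have h0 := hf.2 y hyΩ
  rw [planeLap] at h0
  linarith

theorem Metric.closedBall_subset_of_lt_infDist_frontier {E : Type*} [NormedAddCommGroup E]
    [NormedSpace ℝ E] {s : Set E} (hs : IsOpen s) {p : E} (hp : p ∈ s) {r : ℝ} (hr : 0 ≤ r)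
    (h : r < infDist p (frontier s)) : closedBall p r ⊆ s := by
  refine (convex_closedBall p r).isPreconnected.subset_of_closure_inter_subset hs
    ⟨p, mem_closedBall_self hr, hp⟩ ?_
  rintro y ⟨hy, hyb⟩
  by_contra hys
  have h1 : infDist p (frontier s) ≤ dist p y :=
    infDist_le_dist_of_mem ⟨hy, by rwa [hs.interior_eq]⟩
  rw [mem_closedBall, dist_comm] at hyb
  linarith

theorem RegPart.le_of_mem_closedBall {Ω : Set ℂ} {H : ℂ → ℂ → ℝ} (hH : RegPart Ω H)
    (hΩo : IsOpen Ω) (hΩb : Bornology.IsBounded Ω) {p : ℂ} (hp : p ∈ Ω) {r : ℝ} (hr : 0 ≤ r)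
    (h : r < infDist p (frontier Ω)) {x y : ℂ} (hx : x ∈ closedBall p r) (hy : y ∈ Ω) :
    1 / (2 * π) * Real.log (infDist p (frontier Ω) - r) ≤ H x y := by
  obtain ⟨hharm, hcont, hbd⟩ :=
    hH.1 x (closedBall_subset_of_lt_infDist_frontier hΩo hp hr h hx)
  refine hharm.le_of_le_on_frontier hΩo hΩb hcont (fun z hz => ?_) hy
  rw [hbd z hz]
  have h1 : infDist p (frontier Ω) ≤ dist p z := infDist_le_dist_of_mem hz
  have h2 : dist p z ≤ dist x p + dist x z := dist_triangle_left p z x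
  rw [mem_closedBall] at hx
  rw [← dist_eq_norm]
  gcongr
  linarith

theorem exists_inBlk {m N : ℕ} (Nr : Fin m → ℕ) (hN : N = ∑ r, Nr r) (j : Fin N) :
    ∃ r, inBlk Nr r j := by
  let F : ℕ → ℕ := fun k => ∑ s ∈ Finset.univ.filter (fun s : Fin m => (s : ℕ) < k), Nr s
  have hF : ∃ k, (j : ℕ) < F k := ⟨m, by
    have : F m = ∑ r, Nr r := by simp [F]
    rw [this, ← hN]
    exact j.2⟩
  classical
  have hlt := Nat.find_spec hF
  have hmin := fun k => Nat.find_min hF (m := k)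
  set K := Nat.find hF
  obtain _ | k := K
  · simp [F] at hlt
  have hle : F k ≤ j := not_lt.1 (hmin k k.lt_succ_self)
  have hkm : k < m := by
    by_contra! hmk
    have : F (k + 1) = F k := by
      simp only [F]
      congr 1
      ext s
      have := s.2
      simp only [Finset.mem_filter, Finset.mem_univ, true_and]
      omega
    omega
  have hsucc : F (k + 1) = F k + Nr ⟨k, hkm⟩ := by
    have : Finset.univ.filter (fun s : Fin m => (s : ℕ) < k + 1) =
        insert ⟨k, hkm⟩ (Finset.univ.filter (fun s : Fin m => (s : ℕ) < k)) := by
      ext s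
      simp only [Finset.mem_filter, Finset.mem_univ, true_and, Finset.mem_insert, Fin.ext_iff]
      omega
    simp only [F]
    rw [this, Finset.sum_insert (by simp), add_comm]
  have hlo : blkLo Nr ⟨k, hkm⟩ = F k := by
    simp only [blkLo, F, Fin.lt_def]
  exact ⟨⟨k, hkm⟩, by rw [inBlk, hlo]; omega⟩

theorem mem_annulus_of_mem_Kset {δ : ℝ} {m : ℕ} {P : Fin m → ℂ} {Nr : Fin m → ℕ} {N : ℕ}
    {ξ0 ξ : Fin N → ℂ} {M : ℝ} (hξ : ξ ∈ Kset δ P Nr ξ0 M) {r : Fin m} {j : Fin N}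
    (hj : inBlk Nr r j) : δ ≤ ‖ξ j - P r‖ ∧ ‖ξ j - P r‖ ≤ 2 * δ := by
  have hcont : Continuous fun η : Fin N → ℂ => ‖η j - P r‖ := by fun_prop
  have hclosed : IsClosed {η : Fin N → ℂ | ‖η j - P r‖ ∈ Icc δ (2 * δ)} :=
    isClosed_Icc.preimage hcont
  refine closure_minimal (fun η hη => ?_) hclosed hξ
  have := (connectedComponentIn_subset _ _ hη).1 r j hj
  exact ⟨this.1.le, this.2.le⟩

theorem sum_sum_ite_ne_ge {N : ℕ} {g : Fin N → Fin N → ℝ} {E : ℝ} (hE : 0 ≤ E)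
    (hg : ∀ j k, j ≠ k → -E ≤ g j k) {j₀ k₀ : Fin N} (h : j₀ ≠ k₀) :
    g j₀ k₀ - (N : ℝ) * N * E ≤ ∑ j, ∑ k, if j ≠ k then g j k else 0 := by
  have hnn : ∀ j k, 0 ≤ (if j ≠ k then g j k else 0) + E := fun j k => by
    split_ifs with hjk
    · linarith [hg j k hjk]
    · linarith
  have h1 : (if j₀ ≠ k₀ then g j₀ k₀ else 0) + E ≤ ∑ k, ((if j₀ ≠ k then g j₀ k else 0) + E) :=
    Finset.single_le_sum (fun k _ => hnn j₀ k) (Finset.mem_univ k₀)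
  have h2 : ∑ k, ((if j₀ ≠ k then g j₀ k else 0) + E) ≤
      ∑ j, ∑ k, ((if j ≠ k then g j k else 0) + E) :=
    Finset.single_le_sum (f := fun j => ∑ k, ((if j ≠ k then g j k else 0) + E))
      (fun j _ => Finset.sum_nonneg fun k _ => hnn j k) (Finset.mem_univ j₀)
  rw [if_pos h] at h1
  simp only [Finset.sum_add_distrib, Finset.sum_const, Finset.card_univ, Fintype.card_fin,
    nsmul_eq_mul] at h1 h2 ⊢
  linarith

/-- min_{ξ∈K₀}Ψ(ξ) → +∞ as M → +∞: for every R there is M₁ > 0 such that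
Ψ(ξ) ≥ R for every M ≥ M₁ and every ξ ∈ K₀. -/
theorem psi_on_K0_tendsto_top (Ω : Set ℂ) (hΩo : IsOpen Ω) (hΩc : IsConnected Ω)
    (hΩb : Bornology.IsBounded Ω) (H : ℂ → ℂ → ℝ) (hH : RegPart Ω H)
    (Z : Finset ℂ) (hZ : (Z : Set ℂ) ⊆ Ω) (α : ℂ → ℝ) (hα : ∀ p ∈ Z, 0 < α p)
    (N : ℕ) (hN : 1 ≤ N) (θ : ℂ → ℝ) (δ : ℝ) (hδ0 : 0 < δ) (hδπ : δ < π / 2)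
    (hcones : ∀ p ∈ Z, ∀ q ∈ Z, p ≠ q → Disjoint (coneAt θ δ p) (coneAt θ δ q))
    (hdist : ∀ p ∈ Z, 2 * δ < Metric.infDist p (frontier Ω))
    (hsepZ : ∀ p ∈ Z, ∀ q ∈ Z, p ≠ q → 4 * δ < ‖p - q‖)
    (m : ℕ) (hm : 1 ≤ m) (P : Fin m → ℂ) (hPinj : Function.Injective P)
    (hPZ : ∀ r, P r ∈ Z) (Nr : Fin m → ℕ) (hNr1 : ∀ r, 1 ≤ Nr r)
    (hNrα : ∀ r, (Nr r : ℝ) < 1 + α (P r)) (hNsum : N = ∑ r, Nr r)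
    (ξ0 : Fin N → ℂ)
    (hξ0 : ∀ r : Fin m, ∀ j : Fin N, inBlk Nr r j →
      ξ0 j = P r + ((3 / 2 * δ : ℝ) : ℂ) *
        Complex.exp (((θ (P r) + ((j : ℕ) + 1) * δ / (N : ℝ) : ℝ) : ℂ) * Complex.I)) :
    ∀ R : ℝ, ∃ M₁ : ℝ, 0 < M₁ ∧ ∀ M : ℝ, M₁ ≤ M →
      ∀ ξ ∈ K0set δ P Nr ξ0 M, R ≤ PsiFun H Z α ξ := by
  classical
  intro R
  have hball : ∀ p ∈ Z, closedBall p (2 * δ) ⊆ Ω := fun p hp =>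
    closedBall_subset_of_lt_infDist_frontier hΩo (hZ hp) (by positivity) (hdist p hp)
  -- a common lower bound for `H` near the points `P r`
  obtain ⟨C, hC⟩ := Finite.exists_le fun r =>
    |1 / (2 * π) * Real.log (infDist (P r) (frontier Ω) - 2 * δ)|
  have hC0 : 0 ≤ C := (abs_nonneg _).trans (hC ⟨0, hm⟩)
  have hHlow : ∀ r, ∀ x ∈ closedBall (P r) (2 * δ), ∀ y ∈ Ω, -C ≤ H x y := fun r x hx y hy =>
    (neg_le_neg (hC r)).trans <| (neg_abs_le _).trans <|
      hH.le_of_mem_closedBall hΩo hΩb (hZ (hPZ r)) (by positivity) (hdist _ (hPZ r)) hx hy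
  have hHup : ∀ p : ℂ, ∃ B : ℝ, p ∈ Z → ∀ x ∈ Ω, H p x ≤ B := fun p => by
    by_cases hp : p ∈ Z
    · obtain ⟨B, hB⟩ := hΩb.isCompact_closure.bddAbove_image (hH.1 p (hZ hp)).2.1
      exact ⟨B, fun _ x hx => hB ⟨x, subset_closure hx, rfl⟩⟩
    · exact ⟨0, fun h => absurd h hp⟩
  choose B hB using hHup
  set κ : ℝ := 1 / (2 * π) with hκ
  have hκ0 : 0 < κ := by positivity
  set D : ℝ := diam Ω + 1 with hD
  have hD1 : 1 ≤ D := by linarith [diam_nonneg (s := Ω)]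
  set E : ℝ := κ * Real.log D + C with hE
  have hE0 : 0 ≤ E := add_nonneg (mul_nonneg hκ0.le (Real.log_nonneg hD1)) hC0
  set A : ℝ := ∑ p ∈ Z, (α p / 2) * (N * (κ * Real.log (1 / δ) + B p)) with hA
  set Q : ℝ := 2 * (R + 1 / 2 * (N * C) + A) + N * N * E + C with hQ
  refine ⟨Real.exp (Q / κ), Real.exp_pos _, fun M hM ξ hξ => ?_⟩
  have hM0 : 0 < M := (Real.exp_pos _).trans_le hM
  have hlogM : Q ≤ κ * Real.log M := by
    have := (Real.le_log_iff_exp_le hM0).2 hM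
    rw [div_le_iff₀ hκ0] at this
    linarith
  obtain ⟨hξK, hξsep, j₀, k₀, hjk₀, hmin⟩ := hξ
  choose r hr using exists_inBlk Nr hNsum
  have hann := fun j => mem_annulus_of_mem_Kset hξK (hr j)
  have hξball : ∀ j, ξ j ∈ closedBall (P (r j)) (2 * δ) := fun j =>
    mem_closedBall_iff_norm.2 (hann j).2
  have hξΩ : ∀ j, ξ j ∈ Ω := fun j => hball _ (hPZ _) (hξball j)
  have hξH : ∀ j k, -C ≤ H (ξ j) (ξ k) := fun j k => hHlow _ _ (hξball j) _ (hξΩ k)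
  have hfar : ∀ j, ∀ p ∈ Z, δ ≤ ‖ξ j - p‖ := fun j p hp => by
    by_cases hpr : p = P (r j)
    · rw [hpr]; exact (hann j).1
    · have h1 := hsepZ _ (hPZ (r j)) p hp (Ne.symm hpr)
      have h2 : ‖P (r j) - p‖ ≤ ‖ξ j - P (r j)‖ + ‖ξ j - p‖ := by
        simpa only [dist_eq_norm] using dist_triangle_left (P (r j)) p (ξ j)
      linarith [(hann j).2]
  have hself : -(N * C) ≤ ∑ j, H (ξ j) (ξ j) := by
    simpa using Finset.card_nsmul_le_sum Finset.univ (fun j => H (ξ j) (ξ j)) (-C)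
      fun j _ => hξH j j
  have hsing : ∑ p ∈ Z, (α p / 2) * ∑ j, green H (ξ j) p ≤ A := by
    refine Finset.sum_le_sum fun p hp => mul_le_mul_of_nonneg_left ?_ (half_pos (hα p hp)).le
    have : ∀ j ∈ Finset.univ, green H (ξ j) p ≤ κ * Real.log (1 / δ) + B p := fun j _ => by
      have hd := hfar j p hp
      rw [green, hH.2 _ (hξΩ j) _ (hZ hp)]
      refine add_le_add (mul_le_mul_of_nonneg_left (Real.log_le_log ?_ ?_) hκ0.le)
        (hB p hp _ (hξΩ j))
      · exact one_div_pos.2 (hδ0.trans_le hd)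
      · exact one_div_le_one_div_of_le hδ0 hd
    simpa only [Finset.card_univ, Fintype.card_fin, nsmul_eq_mul] using
      Finset.sum_le_card_nsmul _ _ _ this
  have hpair : ∀ j k, j ≠ k → -E ≤ green H (ξ j) (ξ k) := fun j k hjk => by
    have hpos : 0 < ‖ξ j - ξ k‖ := (inv_pos.2 hM0).trans_le (hξsep j k hjk)
    have hle : ‖ξ j - ξ k‖ ≤ D := by
      have := dist_le_diam_of_mem hΩb (hξΩ j) (hξΩ k)
      rw [dist_eq_norm] at this
      linarith
    have hlog := mul_le_mul_of_nonneg_left (Real.log_le_log hpos hle) hκ0.le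
    rw [green, one_div ‖_‖, Real.log_inv]
    linarith [hξH j k]
  have hpair₀ : κ * Real.log M - C ≤ green H (ξ j₀) (ξ k₀) := by
    rw [green, hmin, one_div, one_div, inv_inv]
    rw [hκ, one_div]
    linarith [hξH j₀ k₀]
  have hsum := sum_sum_ite_ne_ge hE0 hpair hjk₀
  rw [PsiFun]
  linarith
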